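/- For every m ≥ 1, all distinct points x₁, …, x_m ∈ ℝ^d, every finite configuration ω ⊆ ℝ^d, all integers k₁, …, k_m ≥ 1, and every family Θ₁, …, Θ_m of nonempty subsets of {x₁,…,x_m} whose union Θ₁ ∪ ⋯ ∪ Θ_m equals {x₁,…,x_m}, there exists an index i ∈ {1,…,m} such that D_{Θ_i}(ω' ↦ τ^{(k_i)}(x_i, ω'))(ω) = 0 in ℝ^d. In particular, the interacting transformation τ satisfies the vanishing condition: the product of the differences D_{Θ₁} τ^{(k₁)}(x₁, ω) ⋯ D_{Θ_m} τ^{(k_m)}(x_m, ω) vanishes. -/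

import Mathlib

noncomputable section

open Classical

/-- `ℝ^d` with the Euclidean norm. -/
abbrev Rd (d : ℕ) := EuclideanSpace ℝ (Fin d)

/-- The induced transformation `τ_*` on configurations: `τ_* ω = {τ(x,ω) : x ∈ ω}`. -/
def tauStar {X : Type*} (τ : X → Set X → X) (ω : Set X) : Set X :=
  (fun x => τ x ω) '' ω

/-- The iterates `τ^{(n)}`: `τ^{(0)}(x,ω) = x`,
`τ^{(n)}(x,ω) = τ^{(n-1)}(τ(x,ω), τ_* ω)`. -/
def tauIter {X : Type*} (τ : X → Set X → X) : ℕ → X → Set X → X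
  | 0, x, _ => x
  | n + 1, x, ω => tauIter τ n (τ x ω) (tauStar τ ω)

/-- The set `ω_e` of extreme points of the convex hull of the configuration `ω`. -/
def extPts {d : ℕ} (ω : Set (Rd d)) : Set (Rd d) :=
  (convexHull ℝ ω).extremePoints ℝ

/-- The iterated difference operator
`D_Θ G(ω) := Σ_{η ⊆ Θ} (-1)^{|Θ| - |η|} G(ω ∪ η)` for functions of configurations
with values in a commutative additive group. -/
def DTheta {X : Type*} {A : Type*} [AddCommGroup A]
    (Θ : Finset X) (G : Set X → A) (ω : Set X) : A :=
  ∑ η ∈ Θ.powerset, (-1 : ℤ) ^ (Θ.card - η.card) • G (ω ∪ ↑η)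

section Helpers

variable {d : ℕ}

/-- A map of `ℝ^d` preserving weak betweenness maps lines into lines. -/
lemma wb_line {g : Rd d → Rd d} (hginj : Function.Injective g)
    (hg : ∀ a b c, Wbtw ℝ a b c → Wbtw ℝ (g a) (g b) (g c))
    (S : AffineSubspace ℝ (Rd d)) (u v : Rd d) (hu : g u ∈ S) (hv : g v ∈ S) (c : ℝ) :
    g (AffineMap.lineMap u v c) ∈ S := by
  by_cases huv : u = v
  · subst huv; simpa using hu
  set p := AffineMap.lineMap u v c with hp
  have hcol : Collinear ℝ ({u, v, p} : Set (Rd d)) := by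
    have h1 : p ∈ line[ℝ, u, v] := AffineMap.lineMap_mem_affineSpan_pair c u v
    have := collinear_insert_of_mem_affineSpan_pair h1
    convert! this using 1
    ext; simp; tauto
  have hcol' : Collinear ℝ ({g u, g v, g p} : Set (Rd d)) := by
    rcases hcol.wbtw_or_wbtw_or_wbtw with h | h | h
    · exact (hg _ _ _ h).collinear
    · have := (hg _ _ _ h).collinear
      convert! this using 1
      ext; simp; tauto
    · have := (hg _ _ _ h).collinear
      convert! this using 1
      ext; simp; tauto
  have hm : g p ∈ line[ℝ, g u, g v] :=
    hcol'.mem_affineSpan_of_mem_of_ne (by simp) (by simp) (by simp) (fun h => huv (hginj h))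
  have hle : line[ℝ, g u, g v] ≤ S := by
    rw [affineSpan_le]
    intro z hz
    rcases hz with rfl | hz
    · exact hu
    · rw [Set.mem_singleton_iff] at hz; subst hz; exact hv
  exact hle hm

/-- The preimage of an affine subspace is an affine subspace. -/
def wbComap {g : Rd d → Rd d} (hginj : Function.Injective g)
    (hg : ∀ a b c, Wbtw ℝ a b c → Wbtw ℝ (g a) (g b) (g c))
    (S : AffineSubspace ℝ (Rd d)) : AffineSubspace ℝ (Rd d) where
  carrier := {y | g y ∈ S}
  smul_vsub_vadd_mem' := by
    intro c p₁ p₂ p₃ h₁ h₂ h₃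
    have hA := wb_line hginj hg S p₂ p₃ h₂ h₃ 2
    have hB := wb_line hginj hg S p₂ p₁ h₂ h₁ (2 * c)
    have hC := wb_line hginj hg S _ _ hA hB (1 / 2)
    have : AffineMap.lineMap (AffineMap.lineMap p₂ p₃ (2 : ℝ))
        (AffineMap.lineMap p₂ p₁ (2 * c)) (1 / 2 : ℝ) = c • (p₁ -ᵥ p₂ : Rd d) +ᵥ p₃ := by
      simp only [AffineMap.lineMap_apply, vsub_eq_sub, vadd_eq_add]
      module
    rw [this] at hC
    exact hC

lemma wb_affineIndependent {g : Rd d → Rd d} (hgb : Function.Bijective g)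
    (hg : ∀ a b c, Wbtw ℝ a b c → Wbtw ℝ (g a) (g b) (g c)) {u v w : Rd d}
    (h : AffineIndependent ℝ ![u, v, w]) : AffineIndependent ℝ ![g u, g v, g w] := by
  obtain ⟨t, hst, hti, htop⟩ := exists_subset_affineIndependent_affineSpan_eq_top h.range
  have : Finite t := finite_of_fin_dim_affineIndependent ℝ hti
  have : Fintype t := Fintype.ofFinite t
  have hu : u ∈ t := hst ⟨0, rfl⟩
  have hv : v ∈ t := hst ⟨1, rfl⟩
  have hw : w ∈ t := hst ⟨2, rfl⟩
  have hcard : Fintype.card t = Module.finrank ℝ (Rd d) + 1 := by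
    rw [← hti.affineSpan_eq_top_iff_card_eq_finrank_add_one]
    simpa using htop
  set q : t → Rd d := fun i => g i with hq
  have hspan : affineSpan ℝ (Set.range q) = ⊤ := by
    have hle : affineSpan ℝ t ≤ wbComap hgb.1 hg (affineSpan ℝ (Set.range q)) := by
      rw [affineSpan_le]
      intro z hz
      exact subset_affineSpan ℝ _ ⟨⟨z, hz⟩, rfl⟩
    rw [eq_top_iff]
    intro y _
    obtain ⟨z, rfl⟩ := hgb.2 y
    rw [htop] at hle
    exact hle (AffineSubspace.mem_top ℝ _ z)
  have hqi : AffineIndependent ℝ q := by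
    rw [affineIndependent_iff_finrank_vectorSpan_eq ℝ q hcard, ← direction_affineSpan, hspan,
      AffineSubspace.direction_top, finrank_top]
  have hinj : Function.Injective (![⟨u, hu⟩, ⟨v, hv⟩, ⟨w, hw⟩] : Fin 3 → t) := by
    intro i j hij
    apply h.injective
    have := congrArg (Subtype.val) hij
    fin_cases i <;> fin_cases j <;> simpa using this
  have := hqi.comp_embedding ⟨_, hinj⟩
  convert! this using 1
  ext i
  fin_cases i <;> rfl

variable {f : Rd d → Rd d}

/-- A convexity-preserving bijection maps segments onto segments. -/
lemma image_seg (hf_bij : Function.Bijective f)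
    (hf_conv : ∀ s : Set (Rd d), Convex ℝ s → Convex ℝ (f '' s)) (a b : Rd d) :
    f '' segment ℝ a b = segment ℝ (f a) (f b) := by
  have hsup : ∀ a b : Rd d, segment ℝ (f a) (f b) ⊆ f '' segment ℝ a b := fun a b =>
    (hf_conv _ (convex_segment a b)).segment_subset
      ⟨a, left_mem_segment ℝ a b, rfl⟩ ⟨b, right_mem_segment ℝ a b, rfl⟩
  apply Set.Subset.antisymm _ (hsup a b)
  have hw : ∀ a b c, Wbtw ℝ (f a) (f b) (f c) → Wbtw ℝ a b c := by
    intro a b c h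
    rw [← mem_segment_iff_wbtw] at h ⊢
    obtain ⟨z, hz, hzb⟩ := hsup a c h
    rwa [← hf_bij.1 hzb]
  obtain ⟨g, hgf, hfg⟩ := Function.bijective_iff_has_inverse.1 hf_bij
  have hgb : Function.Bijective g := Function.bijective_iff_has_inverse.2 ⟨f, hfg, hgf⟩
  have hg : ∀ a b c, Wbtw ℝ a b c → Wbtw ℝ (g a) (g b) (g c) := by
    intro a b c h
    apply hw
    rwa [hfg, hfg, hfg]
  rintro _ ⟨c, hc, rfl⟩
  rw [mem_segment_iff_wbtw] at hc ⊢
  have hcol : Collinear ℝ ({f a, f c, f b} : Set (Rd d)) := by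
    rw [collinear_iff_not_affineIndependent_set]
    intro hi
    have := wb_affineIndependent hgb hg hi
    rw [hgf, hgf, hgf, affineIndependent_iff_not_collinear_set] at this
    exact this hc.collinear
  rcases hcol.wbtw_or_wbtw_or_wbtw with h | h | h
  · exact h
  · have h2 := hw _ _ _ h
    have : c = b := hc.swap_right_iff.1 h2.symm
    subst this; exact wbtw_self_right ℝ _ _
  · have h2 := hw _ _ _ h
    have : a = c := hc.rotate_iff.1 h2
    subst this; exact wbtw_self_left ℝ _ _

lemma image_hull (hf_bij : Function.Bijective f)
    (hf_conv : ∀ s : Set (Rd d), Convex ℝ s → Convex ℝ (f '' s)) (A : Set (Rd d)) :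
    convexHull ℝ (f '' A) = f '' convexHull ℝ A := by
  apply Set.Subset.antisymm
  · exact convexHull_min (Set.image_mono (subset_convexHull ℝ A))
      (hf_conv _ (convex_convexHull ℝ A))
  · rw [Set.image_subset_iff]
    apply convexHull_min
    · intro a ha
      exact subset_convexHull ℝ _ ⟨a, ha, rfl⟩
    · rw [convex_iff_segment_subset]
      intro a ha b hb z hz
      have hz' : f z ∈ segment ℝ (f a) (f b) := by
        rw [← image_seg hf_bij hf_conv]; exact ⟨z, hz, rfl⟩
      exact (convex_convexHull ℝ (f '' A)).segment_subset ha hb hz'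

/-- Algebraic interior points of a convex set are interior points. -/
lemma mem_interior_of_core {C : Set (Rd d)} (hC : Convex ℝ C) {y : Rd d} (hy : y ∈ C)
    (h : ∀ z, z ≠ y → ∃ w ∈ C, w ≠ y ∧ w ∈ segment ℝ y z) : y ∈ interior C := by
  have htop : affineSpan ℝ C = ⊤ := by
    rw [eq_top_iff]
    intro z _
    by_cases hz : z = y
    · subst hz; exact subset_affineSpan ℝ _ hy
    obtain ⟨w, hw, hwy, hs⟩ := h z hz
    rw [segment_eq_image_lineMap] at hs
    obtain ⟨c, hc, rfl⟩ := hs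
    have hc0 : c ≠ 0 := by rintro rfl; simp at hwy
    have h3 := AffineMap.lineMap_mem (Q := affineSpan ℝ C) c⁻¹
      (subset_affineSpan ℝ _ hy) (subset_affineSpan ℝ _ hw)
    simpa [AffineMap.lineMap_apply, smul_smul, hc0] using h3
  obtain ⟨p, hp⟩ := hC.interior_nonempty_iff_affineSpan_eq_top.2 htop
  by_cases hpy : p = y
  · exact hpy ▸ hp
  obtain ⟨w, hw, hwy, hs⟩ := h ((2 : ℝ) • y - p) (by
    intro e
    apply hpy
    have : p - y = 0 := by
      calc p - y = y - ((2 : ℝ) • y - p) := by module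
        _ = 0 := by rw [e, sub_self]
    exact sub_eq_zero.1 this)
  apply hC.openSegment_interior_self_subset_interior hp hw
  rw [segment_eq_image_lineMap] at hs
  obtain ⟨c, ⟨hc0, hc1⟩, rfl⟩ := hs
  have hcne : c ≠ 0 := by rintro rfl; simp at hwy
  have hcpos : 0 < c := lt_of_le_of_ne hc0 (Ne.symm hcne)
  refine ⟨c / (1 + c), 1 / (1 + c), by positivity, by positivity, by field_simp; ring, ?_⟩
  rw [AffineMap.lineMap_apply, vsub_eq_sub, vadd_eq_add]
  have h1 : (1 + c) ≠ 0 := by positivity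
  match_scalars <;> field_simp <;> ring

lemma core_of_mem_interior {C : Set (Rd d)} {y : Rd d} (hy : y ∈ interior C) (z : Rd d)
    (hz : z ≠ y) : ∃ w ∈ C, w ≠ y ∧ w ∈ segment ℝ y z := by
  have hcont : Filter.Tendsto (fun c : ℝ => AffineMap.lineMap y z c) (nhdsWithin 0 (Set.Ioi 0))
      (nhds y) := by
    have : Continuous (fun c : ℝ => (AffineMap.lineMap y z c : Rd d)) :=
      AffineMap.lineMap_continuous
    have h := this.tendsto 0
    simp only [AffineMap.lineMap_apply_zero] at h
    exact h.mono_left nhdsWithin_le_nhds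
  have h1 := hcont.eventually (mem_interior_iff_mem_nhds.1 hy)
  have h2 : ∀ᶠ c : ℝ in nhdsWithin 0 (Set.Ioi 0), c ∈ Set.Ioo (0 : ℝ) 1 :=
    Ioo_mem_nhdsGT one_pos
  obtain ⟨c, hc, hc0, hc1⟩ := (h1.and h2).exists
  refine ⟨_, hc, ?_, ?_⟩
  · intro e
    rw [AffineMap.lineMap_eq_left_iff] at e
    rcases e with e | e
    · exact hz e.symm
    · exact hc0.ne' e
  · rw [segment_eq_image_lineMap]
    exact ⟨c, ⟨hc0.le, hc1.le⟩, rfl⟩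

lemma interior_of_image (hf_bij : Function.Bijective f)
    (hf_conv : ∀ s : Set (Rd d), Convex ℝ s → Convex ℝ (f '' s)) {C : Set (Rd d)}
    (hC : Convex ℝ C) {y : Rd d} (hy : f y ∈ interior (f '' C)) : y ∈ interior C := by
  apply mem_interior_of_core hC
  · obtain ⟨z, hz, e⟩ := interior_subset hy
    rwa [← hf_bij.1 e]
  · intro z hz
    obtain ⟨w, ⟨w', hw', rfl⟩, hne, hs⟩ := core_of_mem_interior hy (f z)
      (fun e => hz (hf_bij.1 e))
    refine ⟨w', hw', fun e => hne (by rw [e]), ?_⟩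
    rw [← image_seg hf_bij hf_conv] at hs
    obtain ⟨v, hv, e⟩ := hs
    rwa [← hf_bij.1 e]

lemma hull_ext {ω : Set (Rd d)} (hω : ω.Finite) :
    convexHull ℝ (extPts ω) = convexHull ℝ ω := by
  have h := closure_convexHull_extremePoints (hω.isCompact_convexHull ℝ) (convex_convexHull ℝ ω)
  have hfin : (extPts ω).Finite := hω.subset extremePoints_convexHull_subset
  rw [← h]
  exact (hfin.isClosed_convexHull ℝ).closure_eq.symm

lemma ext_not_interior (hd : 1 ≤ d) {ω : Set (Rd d)} {e : Rd d} (he : e ∈ extPts ω) :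
    e ∉ interior (convexHull ℝ ω) := by
  have : Nonempty (Fin d) := ⟨⟨0, hd⟩⟩
  intro h
  exact Set.disjoint_left.1 (disjoint_interior_extremePoints _) h he

lemma DTheta_const {X A : Type*} [AddCommGroup A] (Θ : Finset X) (hΘ : Θ.Nonempty)
    (G : Set X → A) (ω : Set X) (a : A) (h : ∀ η ⊆ Θ, G (ω ∪ ↑η) = a) : DTheta Θ G ω = 0 := by
  unfold DTheta
  have h1 : ∀ η ∈ Θ.powerset, (-1 : ℤ) ^ (Θ.card - η.card) • G (ω ∪ ↑η) =
      ((-1 : ℤ) ^ Θ.card * (-1) ^ η.card) • a := by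
    intro η hη
    rw [Finset.mem_powerset] at hη
    rw [h η hη]
    congr 1
    have hle := Finset.card_le_card hη
    have : Θ.card = (Θ.card - η.card) + η.card := by omega
    conv_rhs => rw [this, pow_add, mul_assoc, ← mul_pow]
    simp
  rw [Finset.sum_congr rfl h1, ← Finset.sum_smul, ← Finset.mul_sum,
    Finset.sum_powerset_neg_one_pow_card_of_nonempty hΘ]
  simp

end Helpers

/-- For distinct points `x₁, …, x_m`, a finite configuration `ω`, integers
`k₁, …, k_m ≥ 1`, and nonempty subsets `Θ₁, …, Θ_m` of `{x₁,…,x_m}` with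
`Θ₁ ∪ ⋯ ∪ Θ_m = {x₁,…,x_m}`, there is an index `i` with
`D_{Θ_i} τ^{(k_i)}(x_i, ·)(ω) = 0`; in particular the product of the differences
`D_{Θ₁} τ^{(k₁)}(x₁,ω) ⋯ D_{Θ_m} τ^{(k_m)}(x_m,ω)` vanishes. -/
theorem DTheta_tauIter_vanishing (d : ℕ) (hd : 1 ≤ d) (m : ℕ) (hm : 1 ≤ m)
    (f : Rd d → Rd d) (hf_bij : Function.Bijective f)
    (hf_conv : ∀ s : Set (Rd d), Convex ℝ s → Convex ℝ (f '' s))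
    (τhat : Rd d → Set (Rd d) → Rd d)
    (h_ext : ∀ (x : Rd d) (ω : Set (Rd d)), ω.Finite → τhat x ω = τhat x (extPts ω))
    (h_in : ∀ (x : Rd d) (ω : Set (Rd d)), ω.Finite →
      x ∈ interior (convexHull ℝ (extPts ω)) →
      τhat x ω ∈ interior (convexHull ℝ (extPts ω)))
    (h_out : ∀ (x : Rd d) (ω : Set (Rd d)), ω.Finite →
      x ∉ interior (convexHull ℝ (extPts ω)) → τhat x ω = x)
    (x : Fin m → Rd d) (hx : Function.Injective x)
    (ω : Set (Rd d)) (hω : ω.Finite)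
    (k : Fin m → ℕ) (hk : ∀ i, 1 ≤ k i)
    (Θ : Fin m → Finset (Rd d)) (hΘne : ∀ i, (Θ i).Nonempty)
    (hΘsub : ∀ i, Θ i ⊆ Finset.image x Finset.univ)
    (hΘunion : Finset.univ.sup Θ = Finset.image x Finset.univ) :
    ∃ i : Fin m,
      DTheta (Θ i) (fun ω' => tauIter (fun y ω'' => f (τhat y ω'')) (k i) (x i) ω') ω
        = 0 := by
  set τ : Rd d → Set (Rd d) → Rd d := fun y ω'' => f (τhat y ω'') with hτ
  have hfin : ∀ ω : Set (Rd d), ω.Finite → (tauStar τ ω).Finite := fun ω h => h.image _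
  have hout : ∀ (y : Rd d) (ω : Set (Rd d)), ω.Finite → y ∉ interior (convexHull ℝ ω) →
      τhat y ω = y := by
    intro y ω h hy
    apply h_out y ω h
    rwa [hull_ext h]
  have hhull : ∀ ω : Set (Rd d), ω.Finite →
      convexHull ℝ (tauStar τ ω) = f '' convexHull ℝ ω := by
    intro ω h
    have e1 : tauStar τ ω = f '' ((fun y => τhat y ω) '' ω) := by
      rw [Set.image_image]; rfl
    rw [e1, image_hull hf_bij hf_conv]
    congr 1
    apply Set.Subset.antisymm
    · apply convexHull_min _ (convex_convexHull ℝ ω)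
      rintro _ ⟨y, hy, rfl⟩
      by_cases hyi : y ∈ interior (convexHull ℝ ω)
      · have := h_in y ω h (by rwa [hull_ext h])
        rw [hull_ext h] at this
        exact interior_subset this
      · simp only [hout y ω h hyi]
        exact subset_convexHull ℝ _ hy
    · rw [← hull_ext h]
      apply convexHull_mono
      intro e he
      exact ⟨e, extremePoints_convexHull_subset he, hout e ω h (ext_not_interior hd he)⟩
  have claimA : ∀ (n : ℕ) (y : Rd d) (ω : Set (Rd d)), ω.Finite →
      y ∉ interior (convexHull ℝ ω) → tauIter τ n y ω = f^[n] y := by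
    intro n
    induction n with
    | zero => intro y ω _ _; rfl
    | succ n ih =>
      intro y ω h hy
      have e : τ y ω = f y := by simp only [hτ, hout y ω h hy]
      rw [tauIter, e, Function.iterate_succ_apply]
      apply ih _ _ (hfin ω h)
      rw [hhull ω h]
      exact fun hc => hy (interior_of_image hf_bij hf_conv (convex_convexHull ℝ ω) hc)
  have claimB : ∀ (n : ℕ) (y : Rd d) (ω₁ ω₂ : Set (Rd d)), ω₁.Finite → ω₂.Finite →
      convexHull ℝ ω₁ = convexHull ℝ ω₂ → tauIter τ n y ω₁ = tauIter τ n y ω₂ := by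
    intro n
    induction n with
    | zero => intros; rfl
    | succ n ih =>
      intro y ω₁ ω₂ h₁ h₂ hh
      have e : τ y ω₁ = τ y ω₂ := by
        simp only [hτ]
        rw [h_ext y ω₁ h₁, h_ext y ω₂ h₂, extPts, extPts, hh]
      rw [tauIter, tauIter, e]
      apply ih _ _ _ (hfin _ h₁) (hfin _ h₂)
      rw [hhull _ h₁, hhull _ h₂, hh]
  set W : Set (Rd d) := ω ∪ Set.range x with hW
  have hWfin : W.Finite := hω.union (Set.finite_range x)
  have hsub : ∀ i, ∀ η ⊆ Θ i, ω ∪ (↑η : Set (Rd d)) ⊆ W := by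
    intro i η hη
    apply Set.union_subset_union_right
    intro z hz
    have := hΘsub i (hη hz)
    simpa using this
  by_cases hcase : ∃ i, x i ∉ interior (convexHull ℝ W)
  · obtain ⟨i, hi⟩ := hcase
    refine ⟨i, DTheta_const _ (hΘne i) _ _ (f^[k i] (x i)) ?_⟩
    intro η hη
    apply claimA _ _ _ (hω.union η.finite_toSet)
    exact fun hc => hi (interior_mono (convexHull_mono (hsub i η hη)) hc)
  · push Not at hcase
    have hWω : convexHull ℝ W ⊆ convexHull ℝ ω := by
      rw [← hull_ext hWfin]
      apply convexHull_mono
      intro e he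
      rcases extremePoints_convexHull_subset he with h | ⟨i, rfl⟩
      · exact h
      · exact absurd (hcase i) (ext_not_interior hd he)
    refine ⟨⟨0, hm⟩, DTheta_const _ (hΘne _) _ _ (tauIter τ (k ⟨0, hm⟩) (x ⟨0, hm⟩) W) ?_⟩
    intro η hη
    apply claimB _ _ _ _ (hω.union η.finite_toSet) hWfin
    apply Set.Subset.antisymm (convexHull_mono (hsub _ η hη))
    exact hWω.trans (convexHull_mono Set.subset_union_left)
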